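/- arXiv:2305.16689 — 4 statements merged into one kernel-verified Lean document; each statement's English description precedes it below -/
import Mathlib

section
/- The characteristic polynomial of the next-generation matrix J_F · J_V⁻¹ equals X⁴ − R0·X³, i.e., X³·(X − R0). -/
open Matrix Polynomial

/-- The characteristic polynomial of the next-generation matrix `J_F · J_V⁻¹`
equals `X⁴ − R0·X³`, i.e. `X³·(X − R0)`. -/
theorem stmt_1 (Λ μ μP β1 β2 ψ ω σ γS γA ηS ηA δ N : ℝ)
    (hΛ : 0 < Λ) (hμ : 0 < μ) (hμP : 0 < μP) (hβ1 : 0 < β1) (hβ2 : 0 < β2)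
    (hψ : 0 < ψ) (hω : 0 < ω) (hσ : 0 < σ) (hγS : 0 < γS) (hγA : 0 < γA)
    (hηS : 0 < ηS) (hηA : 0 < ηA) (hδ0 : 0 < δ) (hδ1 : δ < 1) (hN : 0 < N)
    (ϖe ϖia ϖis R0 : ℝ)
    (hϖe : ϖe = ψ + μ + ω) (hϖia : ϖia = μ + σ + γA) (hϖis : ϖis = μ + σ + γS)
    (hR0 : R0 = (Λ * N * ω / μ) *
      (β1 * δ * ηS / (μP * ϖe * ϖis) + β2 * δ / (ϖe * ϖis) +
       β1 * (1 - δ) * ηA / (μP * ϖe * ϖia) + β2 * (1 - δ) / (ϖe * ϖia)))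
    (JF JV : Matrix (Fin 4) (Fin 4) ℝ)
    (hJF : JF = !![0, β2 * (Λ * N / μ), β2 * (Λ * N / μ), β1 * (Λ * N / μ);
                   0, 0, 0, 0;
                   0, 0, 0, 0;
                   0, 0, 0, 0])
    (hJV : JV = !![ϖe, 0, 0, 0;
                   -((1 - δ) * ω), ϖia, 0, 0;
                   -(δ * ω), 0, ϖis, 0;
                   0, -ηA, -ηS, μP]) :
    (JF * JV⁻¹).charpoly = X ^ 4 - Polynomial.C R0 * X ^ 3 := by
  have he : ϖe ≠ 0 := by rw [hϖe]; positivity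
  have hia : ϖia ≠ 0 := by rw [hϖia]; positivity
  have his : ϖis ≠ 0 := by rw [hϖis]; positivity
  have hp : μP ≠ 0 := hμP.ne'
  have hm : μ ≠ 0 := hμ.ne'
  clear hϖe hϖia hϖis
  obtain ⟨a, b, c, h0, h1, h2, h3⟩ : ∃ a b c : ℝ,
      R0 * ϖe - a * ((1 - δ) * ω) - b * (δ * ω) = 0 ∧
      a * ϖia - c * ηA = β2 * (Λ * N / μ) ∧
      b * ϖis - c * ηS = β2 * (Λ * N / μ) ∧ c * μP = β1 * (Λ * N / μ) := by
    refine ⟨(β2 * (Λ * N / μ) + β1 * (Λ * N / μ) / μP * ηA) / ϖia,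
      (β2 * (Λ * N / μ) + β1 * (Λ * N / μ) / μP * ηS) / ϖis,
      β1 * (Λ * N / μ) / μP, ?_, ?_, ?_, ?_⟩
    · rw [hR0]; field_simp; ring
    · field_simp; ring
    · field_simp; ring
    · field_simp
  have hdet : IsUnit JV.det := by
    have : JV.det = ϖe * ϖia * ϖis * μP := by
      rw [hJV]
      simp [Matrix.det_succ_row_zero, Fin.sum_univ_succ, Fin.succAbove]
      try ring
    rw [this]
    exact isUnit_iff_ne_zero.mpr (by positivity)
  have hK : JF = !![R0, a, b, c; 0, 0, 0, 0; 0, 0, 0, 0; 0, 0, 0, 0] * JV := by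
    rw [hJF, hJV]
    ext i j
    fin_cases i <;> fin_cases j <;>
      simp [Matrix.mul_apply, Fin.sum_univ_succ] <;> linarith
  rw [hK, Matrix.mul_nonsing_inv_cancel_right _ _ hdet]
  have hU : (!![R0, a, b, c; 0, 0, 0, 0; 0, 0, 0, 0; 0, 0, 0, 0] :
      Matrix (Fin 4) (Fin 4) ℝ).BlockTriangular id := by
    intro i j hij
    fin_cases i <;> fin_cases j <;> simp_all
  rw [Matrix.charpoly_of_upperTriangular _ hU]
  simp [Fin.prod_univ_succ]
  ring
end

section
/- The real spectrum of the next-generation matrix J_F · J_V⁻¹ is exactly the set {0, R0}; in particular R0 is its largest eigenvalue (spectral radius). -/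
open Matrix

/-- The real spectrum of the next-generation matrix `J_F · J_V⁻¹` is exactly `{0, R0}`;
in particular `R0` is its largest eigenvalue (spectral radius). -/
theorem stmt_2 (Λ μ μP β1 β2 ψ ω σ γS γA ηS ηA δ N : ℝ)
    (hΛ : 0 < Λ) (hμ : 0 < μ) (hμP : 0 < μP) (hβ1 : 0 < β1) (hβ2 : 0 < β2)
    (hψ : 0 < ψ) (hω : 0 < ω) (hσ : 0 < σ) (hγS : 0 < γS) (hγA : 0 < γA)
    (hηS : 0 < ηS) (hηA : 0 < ηA) (hδ0 : 0 < δ) (hδ1 : δ < 1) (hN : 0 < N)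
    (ϖe ϖia ϖis R0 : ℝ)
    (hϖe : ϖe = ψ + μ + ω) (hϖia : ϖia = μ + σ + γA) (hϖis : ϖis = μ + σ + γS)
    (hR0 : R0 = (Λ * N * ω / μ) *
      (β1 * δ * ηS / (μP * ϖe * ϖis) + β2 * δ / (ϖe * ϖis) +
       β1 * (1 - δ) * ηA / (μP * ϖe * ϖia) + β2 * (1 - δ) / (ϖe * ϖia)))
    (JF JV : Matrix (Fin 4) (Fin 4) ℝ)
    (hJF : JF = !![0, β2 * (Λ * N / μ), β2 * (Λ * N / μ), β1 * (Λ * N / μ);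
                   0, 0, 0, 0;
                   0, 0, 0, 0;
                   0, 0, 0, 0])
    (hJV : JV = !![ϖe, 0, 0, 0;
                   -((1 - δ) * ω), ϖia, 0, 0;
                   -(δ * ω), 0, ϖis, 0;
                   0, -ηA, -ηS, μP]) :
    spectrum ℝ (JF * JV⁻¹) = ({0, R0} : Set ℝ) ∧
      ∀ x ∈ spectrum ℝ (JF * JV⁻¹), x ≤ R0 := by
  have he : 0 < ϖe := by rw [hϖe]; positivity
  have hia : 0 < ϖia := by rw [hϖia]; positivity
  have his : 0 < ϖis := by rw [hϖis]; positivity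
  have hd : 0 < 1 - δ := by linarith
  have hR0pos : 0 < R0 := by rw [hR0]; positivity
  clear hϖe hϖia hϖis
  obtain ⟨c, hc⟩ : ∃ c, c = β1 * (Λ * N / μ) / μP := ⟨_, rfl⟩
  obtain ⟨b, hb⟩ : ∃ b, b = (β2 * (Λ * N / μ) + c * ηS) / ϖis := ⟨_, rfl⟩
  obtain ⟨a, ha⟩ : ∃ a, a = (β2 * (Λ * N / μ) + c * ηA) / ϖia := ⟨_, rfl⟩
  have h1 : R0 * ϖe - a * ((1 - δ) * ω) - b * (δ * ω) = 0 := by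
    rw [hR0, ha, hb, hc]; field_simp; ring
  have h2 : a * ϖia - c * ηA = β2 * (Λ * N / μ) := by
    rw [ha]; field_simp; ring
  have h3 : b * ϖis - c * ηS = β2 * (Λ * N / μ) := by
    rw [hb]; field_simp; ring
  have h4 : c * μP = β1 * (Λ * N / μ) := by
    rw [hc]; field_simp
  have hdet : JV.det = ϖe * ϖia * ϖis * μP := by
    rw [hJV]
    simp [Matrix.det_succ_row_zero, Fin.sum_univ_succ, Fin.succAbove]
    try ring
  have hunit : IsUnit JV.det := by
    rw [hdet]; exact (by positivity : ϖe * ϖia * ϖis * μP ≠ 0).isUnit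
  have hM : JF = !![R0, a, b, c; 0, 0, 0, 0; 0, 0, 0, 0; 0, 0, 0, 0] * JV := by
    rw [hJF, hJV]
    ext i j
    fin_cases i <;> fin_cases j <;>
      simp [Matrix.mul_apply, Fin.sum_univ_succ] <;> linarith
  have hspec : spectrum ℝ (JF * JV⁻¹) = ({0, R0} : Set ℝ) := by
    rw [hM, Matrix.mul_nonsing_inv_cancel_right _ _ hunit]
    ext x
    have hx : (algebraMap ℝ (Matrix (Fin 4) (Fin 4) ℝ) x -
        !![R0, a, b, c; 0, 0, 0, 0; 0, 0, 0, 0; 0, 0, 0, 0]).det = (x - R0) * x ^ 3 := by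
      have : (algebraMap ℝ (Matrix (Fin 4) (Fin 4) ℝ) x -
        !![R0, a, b, c; 0, 0, 0, 0; 0, 0, 0, 0; 0, 0, 0, 0]) =
          !![x - R0, -a, -b, -c; 0, x, 0, 0; 0, 0, x, 0; 0, 0, 0, x] := by
        ext i j
        fin_cases i <;> fin_cases j <;> simp [Matrix.algebraMap_matrix_apply]
      rw [this]
      simp [Matrix.det_succ_row_zero, Fin.sum_univ_succ, Fin.succAbove]
      left; ring
    rw [spectrum.mem_iff, Matrix.isUnit_iff_isUnit_det, hx, isUnit_iff_ne_zero, not_not]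
    simp [sub_eq_zero, or_comm]
  refine ⟨hspec, ?_⟩
  rw [hspec]
  rintro x (rfl | rfl)
  · exact hR0pos.le
  · exact le_rfl
end

section
/- In the integer-order (order-one) version of the model with constant recruitment Λ·N, if R0 ≤ 1 and at time t the states satisfy S(t) ≥ 0, E(t) ≥ 0, IA(t) ≥ 0, IS(t) ≥ 0, W(t) ≥ 0 and S(t) ≤ Λ·N/μ, then the Lyapunov function V(t) = b0·E(t) + b1·IA(t) + b2·IS(t) + b3·W(t) satisfies V'(t) ≤ 0. -/
theorem stmt_10 (Λ μ μP β1 β2 ψ ω σ γS γA ηS ηA δ φ1 φ2 N : ℝ)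
    (hΛ : 0 < Λ) (hμ : 0 < μ) (hμP : 0 < μP) (hβ1 : 0 < β1) (hβ2 : 0 < β2)
    (hψ : 0 < ψ) (hω : 0 < ω) (hσ : 0 < σ) (hγS : 0 < γS) (hγA : 0 < γA)
    (hηS : 0 < ηS) (hηA : 0 < ηA) (hδ0 : 0 < δ) (hδ1 : δ < 1)
    (hφ1 : 0 ≤ φ1) (hφ2 : 0 ≤ φ2) (hN : 0 < N)
    (ϖe ϖia ϖis R0 b0 b1 b2 b3 : ℝ)
    (hϖe : ϖe = ψ + μ + ω) (hϖia : ϖia = μ + σ + γA) (hϖis : ϖis = μ + σ + γS)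
    (hR0 : R0 = (Λ * N * ω / μ) *
      (β1 * δ * ηS / (μP * ϖe * ϖis) + β2 * δ / (ϖe * ϖis) +
       β1 * (1 - δ) * ηA / (μP * ϖe * ϖia) + β2 * (1 - δ) / (ϖe * ϖia)))
    (hb0 : b0 = μP * ϖia * ϖis * μ)
    (hb1 : b1 = Λ * N * (β1 * ηA + β2 * μP) * ϖis)
    (hb2 : b2 = Λ * N * (β1 * ηS + β2 * μP) * ϖia)
    (hb3 : b3 = Λ * N * β1 * ϖia * ϖis)
    (S E IA IS W : ℝ → ℝ) (t : ℝ)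
    (hE : HasDerivAt E
      (β1 * S t * W t / (1 + φ1 * W t)
        + β2 * S t * (IA t + IS t) / (1 + φ2 * (IA t + IS t))
        - ϖe * E t) t)
    (hIA : HasDerivAt IA ((1 - δ) * ω * E t - ϖia * IA t) t)
    (hIS : HasDerivAt IS (δ * ω * E t - ϖis * IS t) t)
    (hW : HasDerivAt W (ηA * IA t + ηS * IS t - μP * W t) t)
    (hS0 : 0 ≤ S t) (hE0 : 0 ≤ E t) (hIA0 : 0 ≤ IA t) (hIS0 : 0 ≤ IS t)
    (hW0 : 0 ≤ W t) (hSb : S t ≤ Λ * N / μ)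
    (hR0le : R0 ≤ 1) :
    deriv (fun s => b0 * E s + b1 * IA s + b2 * IS s + b3 * W s) t ≤ 0 := by
  have hd := (((hE.const_mul b0).add (hIA.const_mul b1)).add (hIS.const_mul b2)).add
    (hW.const_mul b3)
  have hd' := hd.deriv
  have he : 0 < ϖe := by rw [hϖe]; positivity
  have ha : 0 < ϖia := by rw [hϖia]; positivity
  have hs : 0 < ϖis := by rw [hϖis]; positivity
  have hSμ : S t * μ ≤ Λ * N := (le_div_iff₀ hμ).mp hSb
  have hkey : b0 * ϖe * R0 = ω * (b1 * (1 - δ) + b2 * δ) := by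
    rw [hR0, hb0, hb1, hb2]
    field_simp
    ring
  have hb0p : 0 < b0 := by rw [hb0]; positivity
  have h1 : ω * (b1 * (1 - δ) + b2 * δ) * E t ≤ b0 * ϖe * E t := by
    rw [← hkey]
    apply mul_le_mul_of_nonneg_right _ hE0
    exact mul_le_of_le_one_right (by positivity) hR0le
  have hI0 : 0 ≤ IA t + IS t := add_nonneg hIA0 hIS0
  have gen : ∀ β φ x : ℝ, 0 < β → 0 ≤ φ → 0 ≤ x →
      b0 * (β * S t * x / (1 + φ * x)) ≤ μP * ϖia * ϖis * (Λ * N) * (β * x) := by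
    intro β φ x hβ hφ hx
    have hle : β * S t * x / (1 + φ * x) ≤ β * S t * x :=
      div_le_self (by positivity) (by nlinarith [mul_nonneg hφ hx])
    calc b0 * (β * S t * x / (1 + φ * x)) ≤ b0 * (β * S t * x) :=
          mul_le_mul_of_nonneg_left hle hb0p.le
      _ = μP * ϖia * ϖis * (S t * μ) * (β * x) := by rw [hb0]; ring
      _ ≤ _ := by gcongr
  have h2 := gen β1 φ1 (W t) hβ1 hφ1 hW0
  have h3 := gen β2 φ2 (IA t + IS t) hβ2 hφ2 hI0
  have e1 : b1 * ϖia = b3 * ηA + Λ * N * ϖia * ϖis * β2 * μP := by rw [hb1, hb3]; ring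
  have e2 : b2 * ϖis = b3 * ηS + Λ * N * ϖia * ϖis * β2 * μP := by rw [hb2, hb3]; ring
  have e3 : b3 * μP * W t = μP * ϖia * ϖis * (Λ * N) * (β1 * W t) := by rw [hb3]; ring
  have e1' : b1 * ϖia * IA t = (b3 * ηA + Λ * N * ϖia * ϖis * β2 * μP) * IA t := by rw [e1]
  have e2' : b2 * ϖis * IS t = (b3 * ηS + Λ * N * ϖia * ϖis * β2 * μP) * IS t := by rw [e2]
  refine le_of_eq_of_le hd' ?_
  linarith
end

section
/- The basic reproduction number R0, viewed as a function of the symptomatic proportion δ on (0, 1) with all other parameters fixed, is strictly increasing if and only if (β1·ηS + β2·μP)·ϖia > (β1·ηA + β2·μP)·ϖis, and strictly decreasing if and only if the reverse strict inequality holds; thus the sign of the sensitivity of R0 with respect to δ can be either positive or negative depending on the parameters. -/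
/-- `R0`, as a function of the symptomatic proportion `δ` on `(0, 1)`, is strictly
increasing iff `(β1·ηS + β2·μP)·ϖia > (β1·ηA + β2·μP)·ϖis`, and strictly decreasing
iff the reverse strict inequality holds. -/
theorem stmt_18 (Λ μ μP β1 β2 ψ ω σ γS γA ηS ηA N : ℝ)
    (hΛ : 0 < Λ) (hμ : 0 < μ) (hμP : 0 < μP) (hβ1 : 0 < β1) (hβ2 : 0 < β2)
    (hψ : 0 < ψ) (hω : 0 < ω) (hσ : 0 < σ) (hγS : 0 < γS) (hγA : 0 < γA)
    (hηS : 0 < ηS) (hηA : 0 < ηA) (hN : 0 < N)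
    (ϖe ϖia ϖis : ℝ)
    (hϖe : ϖe = ψ + μ + ω) (hϖia : ϖia = μ + σ + γA) (hϖis : ϖis = μ + σ + γS)
    (R0 : ℝ → ℝ)
    (hR0 : ∀ δ, R0 δ = (Λ * N * ω / μ) *
      (β1 * δ * ηS / (μP * ϖe * ϖis) + β2 * δ / (ϖe * ϖis) +
       β1 * (1 - δ) * ηA / (μP * ϖe * ϖia) + β2 * (1 - δ) / (ϖe * ϖia))) :
    (StrictMonoOn R0 (Set.Ioo 0 1) ↔
        (β1 * ηS + β2 * μP) * ϖia > (β1 * ηA + β2 * μP) * ϖis) ∧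
    (StrictAntiOn R0 (Set.Ioo 0 1) ↔
        (β1 * ηA + β2 * μP) * ϖis > (β1 * ηS + β2 * μP) * ϖia) := by
  have he : 0 < ϖe := by rw [hϖe]; positivity
  have hia : 0 < ϖia := by rw [hϖia]; positivity
  have his : 0 < ϖis := by rw [hϖis]; positivity
  clear hϖe hϖia hϖis
  obtain ⟨K, hK, key⟩ : ∃ K : ℝ, 0 < K ∧ ∀ x y, R0 y - R0 x = K * (y - x) *
      ((β1 * ηS + β2 * μP) * ϖia - (β1 * ηA + β2 * μP) * ϖis) := by
    refine ⟨Λ * N * ω / μ / (μP * ϖe * ϖis * ϖia), by positivity, fun x y => ?_⟩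
    rw [hR0, hR0]
    field_simp
    ring
  have h1 : (1 / 4 : ℝ) ∈ Set.Ioo (0 : ℝ) 1 := by constructor <;> norm_num
  have h2 : (1 / 2 : ℝ) ∈ Set.Ioo (0 : ℝ) 1 := by constructor <;> norm_num
  have h12 : (1 / 4 : ℝ) < 1 / 2 := by norm_num
  have hc : 0 < K * (1 / 2 - 1 / 4) := by
    apply mul_pos hK
    norm_num
  refine ⟨⟨fun h => ?_, fun h x _ y _ hxy => ?_⟩, ⟨fun h => ?_, fun h x _ y _ hxy => ?_⟩⟩
  · have h3 := sub_pos.2 (h h1 h2 h12)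
    rw [key] at h3
    exact sub_pos.1 ((mul_pos_iff_of_pos_left hc).1 h3)
  · apply sub_pos.1
    rw [key]
    exact mul_pos (mul_pos hK (sub_pos.2 hxy)) (sub_pos.2 h)
  · have h3 := sub_neg.2 (h h1 h2 h12)
    rw [key] at h3
    exact sub_neg.1 (neg_of_mul_neg_right h3 hc.le)
  · apply sub_neg.1
    rw [key]
    exact mul_neg_of_pos_of_neg (mul_pos hK (sub_pos.2 hxy)) (sub_neg.2 h)
end
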